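/- arXiv:1712.07830 — 2 statements merged into one kernel-verified Lean document; each statement's English description precedes it below -/
import Mathlib

section
/- Orthonormality of the shifted Legendre polynomials on [0,1]: for all i, j ∈ ℕ, ∫₀¹ p̂ᵢ(τ) p̂ⱼ(τ) dτ = 1 if i = j and 0 otherwise. -/
/-- The shifted Legendre polynomial of degree `j` on `[0,1]`,
`p̂ⱼ(τ) = (-1)ʲ √(2j+1) Σ_{k=0}^{j} C(j,k) C(j+k,k) (-τ)ᵏ`. -/
noncomputable def legendreShifted (j : ℕ) (τ : ℝ) : ℝ :=
  (-1 : ℝ) ^ j * Real.sqrt (2 * j + 1) *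
    ∑ k ∈ Finset.range (j + 1),
      (j.choose k : ℝ) * ((j + k).choose k : ℝ) * (-τ) ^ k

open Polynomial in
/-- Iterated integration by parts for real polynomials on `[0,1]`, when all boundary terms vanish. -/
theorem integral_eval_mul_iterate_derivative (n : ℕ) (q w : ℝ[X])
    (h0 : ∀ k < n, (derivative^[n - 1 - k] q).eval 0 * (derivative^[k] w).eval 0 = 0)
    (h1 : ∀ k < n, (derivative^[n - 1 - k] q).eval 1 * (derivative^[k] w).eval 1 = 0) :
    ∫ x in (0 : ℝ)..1, q.eval x * (derivative^[n] w).eval x =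
      (-1) ^ n * ∫ x in (0 : ℝ)..1, (derivative^[n] q).eval x * w.eval x := by
  induction n generalizing q with
  | zero => simp
  | succ n ih =>
    have parts : ∫ x in (0 : ℝ)..1, q.eval x * (derivative^[n + 1] w).eval x =
        -∫ x in (0 : ℝ)..1, (derivative q).eval x * (derivative^[n] w).eval x := by
      rw [intervalIntegral.integral_mul_deriv_eq_deriv_mul
        (u := fun x => q.eval x) (v := fun x => (derivative^[n] w).eval x)
        (u' := fun x => (derivative q).eval x) (v' := fun x => (derivative^[n + 1] w).eval x)
        (fun x _ => q.hasDerivAt x)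
        (fun x _ => by
          rw [Function.iterate_succ_apply']
          exact (derivative^[n] w).hasDerivAt x)
        ((derivative q).continuous.intervalIntegrable _ _)
        ((derivative^[n + 1] w).continuous.intervalIntegrable _ _)]
      have a0 := h0 n (by omega)
      have a1 := h1 n (by omega)
      simp only [add_tsub_cancel_right, tsub_self, Function.iterate_zero, id] at a0 a1
      rw [a0, a1]
      ring
    rw [parts, ih (derivative q)]
    · rw [← Function.iterate_succ_apply, pow_succ]
      ring
    · intro k hk
      rw [← Function.iterate_succ_apply, show (n - 1 - k).succ = n + 1 - 1 - k by omega]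
      exact h0 k (by omega)
    · intro k hk
      rw [← Function.iterate_succ_apply, show (n - 1 - k).succ = n + 1 - 1 - k by omega]
      exact h1 k (by omega)

open Polynomial in
/-- A derivative of order less than the multiplicity of a root vanishes at that root. -/
theorem eval_iterate_derivative_eq_zero_of_pow_dvd {p : ℝ[X]} {a : ℝ} {n k : ℕ}
    (h : (X - C a) ^ n ∣ p) (hk : k < n) : (derivative^[k] p).eval a = 0 := by
  obtain ⟨r, hr⟩ := pow_sub_dvd_iterate_derivative_of_pow_dvd k h
  rw [hr, eval_mul, eval_pow, eval_sub, eval_X, eval_C, sub_self,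
    zero_pow (by omega), zero_mul]

open Polynomial in
theorem X_sub_C_one_pow_dvd_one_sub_X_pow (n : ℕ) :
    (X - C 1 : ℝ[X]) ^ n ∣ (1 - X) ^ n :=
  pow_dvd_pow_of_dvd ⟨-1, by simp⟩ n

open Polynomial Nat in
theorem integral_pow_mul_one_sub_pow_self (n : ℕ) :
    ∫ x in (0 : ℝ)..1, x ^ n * (1 - x) ^ n = (n ! : ℝ) ^ 2 / ((2 * n + 1)! : ℝ) := by
  have h := integral_eval_mul_iterate_derivative n (X ^ (2 * n)) ((1 - X) ^ n)
    (fun k hk => by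
      rw [eval_iterate_derivative_eq_zero_of_pow_dvd (n := 2 * n) (by simp) (by omega), zero_mul])
    (fun k hk => by
      rw [eval_iterate_derivative_eq_zero_of_pow_dvd (X_sub_C_one_pow_dvd_one_sub_X_pow n) hk,
        mul_zero])
  have hw : derivative^[n] ((1 - X : ℝ[X]) ^ n) = C ((-1) ^ n * (n ! : ℝ)) := by
    have := iterate_derivative_comp_one_sub_X (X ^ n : ℝ[X]) n
    simpa [iterate_derivative_X_pow_eq_smul, descFactorial_self, smul_eq_C_mul, mul_comm] using this
  have hq : (((2 * n).descFactorial n : ℕ) : ℝ) * (n ! : ℝ) = ((2 * n)! : ℝ) := by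
    have := factorial_mul_descFactorial (show n ≤ 2 * n by omega)
    rw [show 2 * n - n = n by omega] at this
    rw [mul_comm]
    exact_mod_cast this
  rw [hw, iterate_derivative_X_pow_eq_smul, show 2 * n - n = n by omega] at h
  simp only [eval_pow, eval_X, eval_C, eval_smul, smul_eq_mul, eval_sub, eval_one, mul_assoc,
    intervalIntegral.integral_mul_const, intervalIntegral.integral_const_mul, integral_pow] at h
  rw [mul_left_comm, one_pow, zero_pow (by omega), sub_zero] at h
  have h' := mul_left_cancel₀ (pow_ne_zero n (by norm_num : (-1 : ℝ) ≠ 0)) h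
  have h2 : (2 * (n : ℝ) + 1) ≠ 0 := by positivity
  rw [eq_div_iff (by positivity), factorial_succ]
  push_cast at h' ⊢
  rw [← hq]
  field_simp at h'
  linear_combination -(n ! : ℝ) * h'

open Polynomial in
theorem legendreShifted_eq_eval (n : ℕ) (x : ℝ) :
    legendreShifted n x =
      (-1 : ℝ) ^ n * √(2 * n + 1) * ((shiftedLegendre n).map (Int.castRingHom ℝ)).eval x := by
  rw [legendreShifted, shiftedLegendre, Polynomial.map_sum, eval_finsetSum]
  congr 1
  refine Finset.sum_congr rfl fun k _ => ?_
  rw [show (n + k).choose k = (n + k).choose n from Nat.choose_symm_add.symm]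
  simp [neg_pow x k]
  ring

open Polynomial Nat in
/-- Rodrigues' formula over `ℝ`. -/
theorem factorial_mul_map_shiftedLegendre (n : ℕ) :
    C (n ! : ℝ) * (shiftedLegendre n).map (Int.castRingHom ℝ) =
      derivative^[n] (X ^ n * (1 - X : ℝ[X]) ^ n) := by
  have h := congrArg (Polynomial.map (Int.castRingHom ℝ)) (factorial_mul_shiftedLegendre_eq n)
  rw [← iterate_derivative_map] at h
  simpa using h

open Polynomial Nat in
theorem factorial_mul_integral_eval_mul_shiftedLegendre (n : ℕ) (q : ℝ[X]) :
    (n ! : ℝ) * ∫ x in (0 : ℝ)..1,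
        q.eval x * ((shiftedLegendre n).map (Int.castRingHom ℝ)).eval x =
      (-1) ^ n * ∫ x in (0 : ℝ)..1, (derivative^[n] q).eval x * (x ^ n * (1 - x) ^ n) := by
  have h := integral_eval_mul_iterate_derivative n q (X ^ n * (1 - X) ^ n)
    (fun k hk => by
      rw [eval_iterate_derivative_eq_zero_of_pow_dvd (n := n) (by simp) hk, mul_zero])
    (fun k hk => by
      rw [eval_iterate_derivative_eq_zero_of_pow_dvd
        (dvd_mul_of_dvd_right (X_sub_C_one_pow_dvd_one_sub_X_pow n) _) hk, mul_zero])
  rw [← factorial_mul_map_shiftedLegendre] at h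
  simp only [eval_mul, eval_C, eval_pow, eval_X, eval_sub, eval_one] at h
  rw [← h, ← intervalIntegral.integral_const_mul]
  congr 1 with x
  ring

open Polynomial in
theorem integral_shiftedLegendre_mul_of_lt {i j : ℕ} (hij : i < j) :
    ∫ x in (0 : ℝ)..1, ((shiftedLegendre i).map (Int.castRingHom ℝ)).eval x *
      ((shiftedLegendre j).map (Int.castRingHom ℝ)).eval x = 0 := by
  have h := factorial_mul_integral_eval_mul_shiftedLegendre j
    ((shiftedLegendre i).map (Int.castRingHom ℝ))
  rw [iterate_derivative_eq_zero
    (natDegree_map_le.trans_lt (by rwa [natDegree_shiftedLegendre]))] at h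
  simpa [Nat.factorial_ne_zero] using h

open Polynomial Nat in
theorem integral_shiftedLegendre_mul_self (n : ℕ) :
    ∫ x in (0 : ℝ)..1, ((shiftedLegendre n).map (Int.castRingHom ℝ)).eval x *
      ((shiftedLegendre n).map (Int.castRingHom ℝ)).eval x = 1 / (2 * n + 1) := by
  have h := factorial_mul_integral_eval_mul_shiftedLegendre n
    ((shiftedLegendre n).map (Int.castRingHom ℝ))
  have hd : derivative^[n] ((shiftedLegendre n).map (Int.castRingHom ℝ)) =
      C ((n ! : ℝ) * ((-1) ^ n * ((n + n).choose n : ℝ))) := by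
    rw [eq_C_of_natDegree_le_zero
      (p := derivative^[n] ((shiftedLegendre n).map (Int.castRingHom ℝ)))
      ((natDegree_iterate_derivative _ n).trans
        (Nat.sub_eq_zero_of_le (natDegree_map_le.trans_eq (natDegree_shiftedLegendre n))).le)]
    simp [coeff_iterate_derivative, descFactorial_self, coeff_shiftedLegendre]
  have hc : ((n + n).choose n : ℝ) * (n ! : ℝ) ^ 2 = ((2 * n)! : ℝ) := by
    have := add_choose_mul_factorial_mul_factorial n n
    rw [two_mul, ← this]
    push_cast
    ring
  have hs : ((-1 : ℝ) ^ n) * (-1) ^ n = 1 := by rw [← mul_pow]; simp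
  have hn : (n ! : ℝ) ≠ 0 := by positivity
  simp only [hd, eval_C, intervalIntegral.integral_const_mul,
    integral_pow_mul_one_sub_pow_self] at h
  refine mul_left_cancel₀ hn (h.trans ?_)
  rw [factorial_succ]
  push_cast
  have h3 : (2 * (n : ℝ) + 1) ≠ 0 := by positivity
  field_simp
  linear_combination ((n + n).choose n : ℝ) * (n ! : ℝ) ^ 2 * hs + hc

/-- **orthonormality of the shifted Legendre polynomials on
`[0,1]`.** For all `i, j ∈ ℕ`,
`∫₀¹ p̂ᵢ(τ) p̂ⱼ(τ) dτ = 1` if `i = j` and `0` otherwise. -/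
theorem legendreShifted_orthonormal (i j : ℕ) :
    (∫ τ in (0 : ℝ)..1, legendreShifted i τ * legendreShifted j τ)
      = if i = j then 1 else 0 := by
  have hc : ∀ i j : ℕ, (∫ τ in (0 : ℝ)..1, legendreShifted i τ * legendreShifted j τ) =
      ((-1) ^ i * √(2 * i + 1)) * ((-1) ^ j * √(2 * j + 1)) *
        ∫ x in (0 : ℝ)..1,
          ((Polynomial.shiftedLegendre i).map (Int.castRingHom ℝ)).eval x *
            ((Polynomial.shiftedLegendre j).map (Int.castRingHom ℝ)).eval x := by
    intro i j
    rw [← intervalIntegral.integral_const_mul]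
    congr 1 with x
    rw [legendreShifted_eq_eval, legendreShifted_eq_eval]
    ring
  rcases lt_trichotomy i j with hij | rfl | hij
  · rw [hc, integral_shiftedLegendre_mul_of_lt hij, mul_zero, if_neg hij.ne]
  · rw [hc, integral_shiftedLegendre_mul_self, if_pos rfl, mul_mul_mul_comm, ← mul_pow,
      Real.mul_self_sqrt (by positivity)]
    have : (2 * (i : ℝ) + 1) ≠ 0 := by positivity
    simp [this]
  · simp_rw [mul_comm (legendreShifted i _)]
    rw [hc, integral_shiftedLegendre_mul_of_lt hij, mul_zero, if_neg hij.ne']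
end

section
/- Hypergeometric series representation of the trigonometric collocation coefficient 𝒜: for every x ∈ ℝ, every τ ∈ [0,1], and every j ∈ ℕ, ∫₀¹ (1−ξ) φ₁((1−ξ)²x) p̂ⱼ(ξτ) dξ = √(2j+1) Σ_{l=0}^{∞} Σ_{k=0}^{j} (−1)^{j+k+l} ( (j+k)! / ( k!(j−k)!(2l+k+2)! ) ) τᵏ xˡ, the double series converging absolutely. -/
open Set

/-- `φ₁(x) = Σ_{l≥0} (-1)ˡ xˡ/(2l+1)!` for `x ∈ ℝ`. -/
noncomputable def phiOneReal (x : ℝ) : ℝ :=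
  ∑' l : ℕ, (-1 : ℝ) ^ l * x ^ l / (Nat.factorial (2 * l + 1) : ℝ)

theorem integral_pow_mul_one_sub_pow (m n : ℕ) :
    ∫ t in (0 : ℝ)..1, t ^ m * (1 - t) ^ n =
      (m.factorial : ℝ) * n.factorial / (m + n + 1).factorial := by
  have h := Complex.betaIntegral_eq_Gamma_mul_div (m + 1) (n + 1)
    (by simp; positivity) (by simp; positivity)
  have hmn : (m + 1 + (n + 1) : ℂ) = ((m + n + 1 : ℕ) : ℂ) + 1 := by push_cast; ring
  rw [hmn, Complex.Gamma_nat_eq_factorial, Complex.Gamma_nat_eq_factorial,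
    Complex.Gamma_nat_eq_factorial, Complex.betaIntegral] at h
  simp only [add_sub_cancel_right, Complex.cpow_natCast] at h
  apply Complex.ofReal_injective
  rw [← intervalIntegral.integral_ofReal]
  push_cast
  exact h

theorem summable_phiOneReal (x : ℝ) :
    Summable fun l : ℕ => (-1 : ℝ) ^ l * x ^ l / (Nat.factorial (2 * l + 1) : ℝ) := by
  refine .of_norm_bounded (Real.summable_pow_div_factorial |x|) fun l => ?_
  rw [norm_div, norm_mul, norm_pow, norm_pow, norm_neg, norm_one, one_pow, one_mul,
    Real.norm_eq_abs, Real.norm_natCast]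
  gcongr
  lia

/-- Termwise integration of the series of `φ₁` against a continuous weight. -/
theorem hasSum_integral_phiOneReal (x : ℝ) {g : ℝ → ℝ} (hg : Continuous g) :
    HasSum
      (fun l : ℕ => ∫ ξ in (0 : ℝ)..1, (1 - ξ) *
        ((-1 : ℝ) ^ l * ((1 - ξ) ^ 2 * x) ^ l / (Nat.factorial (2 * l + 1) : ℝ)) * g ξ)
      (∫ ξ in (0 : ℝ)..1, (1 - ξ) * phiOneReal ((1 - ξ) ^ 2 * x) * g ξ) := by
  refine intervalIntegral.hasSum_integral_of_dominated_convergence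
    (fun l ξ => |x| ^ l / (Nat.factorial l : ℝ) * |g ξ|) (fun l => ?_) (fun l => ?_) ?_ ?_ ?_
  · exact Continuous.aestronglyMeasurable (by fun_prop)
  · refine .of_forall fun ξ hξ => ?_
    rw [uIoc_of_le zero_le_one] at hξ
    have h₀ : 0 ≤ 1 - ξ := by linarith [hξ.2]
    have h₁ : 1 - ξ ≤ 1 := by linarith [hξ.1]
    have hx : |(1 - ξ) ^ 2 * x| ≤ |x| := by
      rw [abs_mul, abs_of_nonneg (by positivity : 0 ≤ (1 - ξ) ^ 2)]
      exact mul_le_of_le_one_left (abs_nonneg x) (pow_le_one₀ h₀ h₁)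
    have hl : (Nat.factorial l : ℝ) ≤ Nat.factorial (2 * l + 1) := by
      exact_mod_cast Nat.factorial_le (by lia)
    rw [norm_mul, norm_mul, norm_div, norm_mul, norm_pow, norm_pow, norm_neg, norm_one, one_pow,
      one_mul, Real.norm_natCast, Real.norm_eq_abs, Real.norm_eq_abs, Real.norm_eq_abs,
      abs_of_nonneg h₀]
    gcongr
    calc (1 - ξ) * (|(1 - ξ) ^ 2 * x| ^ l / (Nat.factorial (2 * l + 1) : ℝ))
        ≤ |(1 - ξ) ^ 2 * x| ^ l / (Nat.factorial (2 * l + 1) : ℝ) :=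
          mul_le_of_le_one_left (by positivity) h₁
      _ ≤ |x| ^ l / (Nat.factorial l : ℝ) := by gcongr
  · exact .of_forall fun ξ _ => (Real.summable_pow_div_factorial |x|).mul_right _
  · simp only [tsum_mul_right]
    exact Continuous.intervalIntegrable (by fun_prop) _ _
  · exact .of_forall fun ξ _ =>
      ((summable_phiOneReal ((1 - ξ) ^ 2 * x)).hasSum.mul_left (1 - ξ)).mul_right (g ξ)

theorem continuous_legendreShifted (j : ℕ) : Continuous (legendreShifted j) := by
  unfold legendreShifted
  fun_prop

/-- The `l`-th term of the termwise integrated series, evaluated by Euler's beta integral. -/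
theorem integral_phiOneReal_term_mul_legendreShifted (x τ : ℝ) (j l : ℕ) :
    ∫ ξ in (0 : ℝ)..1, (1 - ξ) *
        ((-1 : ℝ) ^ l * ((1 - ξ) ^ 2 * x) ^ l / (Nat.factorial (2 * l + 1) : ℝ)) *
          legendreShifted j (ξ * τ) =
      Real.sqrt (2 * j + 1) * ∑ k ∈ Finset.range (j + 1), (-1 : ℝ) ^ (j + k + l) *
        ((Nat.factorial (j + k) : ℝ) /
          ((Nat.factorial k : ℝ) * (Nat.factorial (j - k) : ℝ) *
            (Nat.factorial (2 * l + k + 2) : ℝ))) * τ ^ k * x ^ l := by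
  have hexpand : ∀ ξ : ℝ, (1 - ξ) *
      ((-1 : ℝ) ^ l * ((1 - ξ) ^ 2 * x) ^ l / (Nat.factorial (2 * l + 1) : ℝ)) *
        legendreShifted j (ξ * τ) =
      ∑ k ∈ Finset.range (j + 1), (Real.sqrt (2 * j + 1) * (-1 : ℝ) ^ (j + k + l) *
        (j.choose k : ℝ) * ((j + k).choose k : ℝ) * τ ^ k * x ^ l /
          (Nat.factorial (2 * l + 1) : ℝ)) * (ξ ^ k * (1 - ξ) ^ (2 * l + 1)) := by
    intro ξ
    rw [legendreShifted, ← mul_assoc, Finset.mul_sum]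
    refine Finset.sum_congr rfl fun k _ => ?_
    rw [neg_pow (ξ * τ), mul_pow ξ τ, mul_pow _ x, ← pow_mul]
    ring
  simp only [hexpand]
  rw [intervalIntegral.integral_finsetSum fun k _ =>
    Continuous.intervalIntegrable (by fun_prop) _ _, Finset.mul_sum]
  refine Finset.sum_congr rfl fun k hk => ?_
  have hkj : k ≤ j := Nat.lt_succ_iff.mp (Finset.mem_range.mp hk)
  rw [intervalIntegral.integral_const_mul, integral_pow_mul_one_sub_pow,
    Nat.cast_choose ℝ hkj, Nat.cast_choose ℝ (Nat.le_add_left k j), Nat.add_sub_cancel,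
    show k + (2 * l + 1) + 1 = 2 * l + k + 2 by ring]
  field_simp

theorem summable_abs_double_series (x τ : ℝ) (j : ℕ) :
    Summable fun p : ℕ × Fin (j + 1) => |(-1 : ℝ) ^ (j + p.2 + p.1) *
        ((Nat.factorial (j + p.2) : ℝ) /
          ((Nat.factorial (p.2 : ℕ) : ℝ) * (Nat.factorial (j - p.2) : ℝ) *
            (Nat.factorial (2 * p.1 + p.2 + 2) : ℝ))) * τ ^ (p.2 : ℕ) * x ^ p.1| := by
  rw [summable_prod_of_nonneg fun _ => abs_nonneg _]
  refine ⟨fun l => Summable.of_finite, ?_⟩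
  simp only [tsum_fintype]
  refine summable_sum fun k _ => ?_
  refine .of_nonneg_of_le (fun _ => abs_nonneg _) (fun l => ?_)
    ((Real.summable_pow_div_factorial |x|).mul_left
      ((Nat.factorial (j + k) : ℝ) /
        ((Nat.factorial (k : ℕ) : ℝ) * (Nat.factorial (j - k) : ℝ)) * |τ| ^ (k : ℕ)))
  have hl : (Nat.factorial l : ℝ) ≤ Nat.factorial (2 * l + k + 2) := by
    exact_mod_cast Nat.factorial_le (by lia)
  rw [abs_mul, abs_mul, abs_mul, abs_pow, abs_neg, abs_one, one_pow, one_mul, abs_pow, abs_pow,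
    abs_of_nonneg (by positivity), ← div_div, div_mul_eq_mul_div, div_mul_eq_mul_div,
    mul_div_assoc]
  gcongr

/-- **hypergeometric series representation of the trigonometric
collocation coefficient `𝒜`.** For every `x ∈ ℝ`, `τ ∈ [0,1]` and `j ∈ ℕ`,
`∫₀¹ (1-ξ) φ₁((1-ξ)²x) p̂ⱼ(ξτ) dξ
 = √(2j+1) Σ_{l=0}^{∞} Σ_{k=0}^{j} (-1)^{j+k+l} ((j+k)!/(k!(j-k)!(2l+k+2)!)) τᵏ xˡ`,
the double series converging absolutely. -/
theorem trigonometric_collocation_coefficient_A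
    (x : ℝ) (τ : ℝ) (hτ : τ ∈ Icc (0 : ℝ) 1) (j : ℕ)
    (c : ℕ → ℕ → ℝ)
    (hc : ∀ l k : ℕ,
      c l k = (-1 : ℝ) ^ (j + k + l) *
        ((Nat.factorial (j + k) : ℝ) /
          ((Nat.factorial k : ℝ) * (Nat.factorial (j - k) : ℝ) *
            (Nat.factorial (2 * l + k + 2) : ℝ))) * τ ^ k * x ^ l) :
    Summable (fun p : ℕ × Fin (j + 1) => |c p.1 p.2|) ∧
      (∫ ξ in (0 : ℝ)..1,
          (1 - ξ) * phiOneReal ((1 - ξ) ^ 2 * x) * legendreShifted j (ξ * τ))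
        = Real.sqrt (2 * j + 1) * ∑' l : ℕ, ∑ k ∈ Finset.range (j + 1), c l k := by
  simp only [hc]
  refine ⟨summable_abs_double_series x τ j, ?_⟩
  have h := hasSum_integral_phiOneReal x
    ((continuous_legendreShifted j).comp (continuous_mul_const τ))
  simp only [Function.comp_apply, integral_phiOneReal_term_mul_legendreShifted] at h
  rw [← h.tsum_eq, tsum_mul_left]
end
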